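/- arXiv:2101.05057 — 4 statements merged into one kernel-verified Lean document; each statement's English description precedes it below -/
import Mathlib

section
/- Let A = (Q, Σ, δ) be a partial DFA with n states and let S ⊆ Q be a subset with κ(S) ≥ 2. Then there exists a word w ∈ Σ* of length at most κ(Q) − κ(S) + 1 ≤ n − |S| + 1 such that 1 ≤ κ(δ(S,w)) < κ(S). -/
open scoped Classical

section Defs

variable {Q A : Type*}

/-- Action of a word in a partial DFA with transition function `δ`
(`none` means the undefined value ⊥). -/
def stepWord (δ : Q → A → Option Q) : Q → List A → Option Q
  | q, [] => some q
  | q, a :: w => (δ q a).bind (fun p => stepWord δ p w)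

/-- The image `δ(S, w)` of a set of states under the action of a word. -/
def img (δ : Q → A → Option Q) (S : Set Q) (w : List A) : Set Q :=
  {p | ∃ q ∈ S, stepWord δ q w = some p}

/-- The inseparability equivalence `p ≡ q`. -/
def Insep (δ : Q → A → Option Q) (p q : Q) : Prop :=
  ∀ u : List A, (stepWord δ p u).isSome ↔ (stepWord δ q u).isSome

/-- `κ(S)`: the number of inseparability classes intersecting `S`. -/
noncomputable def kappa (δ : Q → A → Option Q) (S : Set Q) : ℕ :=
  {C : Set Q | ∃ p ∈ S, C = {q | Insep δ p q}}.ncard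

def StronglyConnected (δ : Q → A → Option Q) : Prop :=
  ∀ p q : Q, ∃ w : List A, stepWord δ p w = some q

/-- The transition function of the fixing automaton `A^F`. -/
def fixDelta (δ : Q → A → Option Q) (q : Q) (a : A) : Q := (δ q a).getD q

/-- Action of a word in a complete DFA. -/
def stepWordC (δc : Q → A → Q) (q : Q) (w : List A) : Q := w.foldl δc q

/-- The image of a set of states under the action of a word in a complete DFA. -/
def imgC (δc : Q → A → Q) (S : Set Q) (w : List A) : Set Q :=
  (fun q => stepWordC δc q w) '' S

end Defs

/-- The language of words defined at the state `q`. -/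
def definedWords {Q A : Type*} (δ : Q → A → Option Q) (q : Q) : Set (List A) :=
  {u | (stepWord δ q u).isSome}

/-- The words of length at most `j` defined at the state `q`. -/
def definedWordsUpTo {Q A : Type*} (δ : Q → A → Option Q) (j : ℕ) (q : Q) : Set (List A) :=
  {u | u.length ≤ j} ∩ definedWords δ q

section Helpers

variable {Q A : Type*} (δ : Q → A → Option Q)

theorem insep_iff_definedWords_eq (p q : Q) :
    Insep δ p q ↔ definedWords δ p = definedWords δ q := by
  simp only [Insep, definedWords, Set.ext_iff, Set.mem_ofPred_eq]

theorem kappa_eq_ncard_image (S : Set Q) : kappa δ S = (definedWords δ '' S).ncard := by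
  have h : {C : Set Q | ∃ p ∈ S, C = {q | Insep δ p q}} =
      (fun L => {q | L = definedWords δ q}) '' (definedWords δ '' S) := by
    ext C
    simp only [insep_iff_definedWords_eq, Set.mem_ofPred_eq, Set.mem_image,
      exists_exists_and_eq_and, eq_comm (a := C)]
  rw [kappa, h]
  apply Set.InjOn.ncard_image
  rintro _ ⟨p, -, rfl⟩ L - hL
  have hp := (Set.ext_iff.1 hL p).1 rfl
  exact Eq.symm hp

theorem stepWord_append (q : Q) (w v : List A) :
    stepWord δ q (w ++ v) = (stepWord δ q w).bind fun p => stepWord δ p v := by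
  induction w generalizing q with
  | nil => rfl
  | cons a w ih =>
    simp only [List.cons_append, stepWord, ih]
    cases δ q a <;> rfl

theorem definedWords_of_stepWord_eq_some {p q : Q} {w : List A} (h : stepWord δ q w = some p) :
    definedWords δ p = {v | w ++ v ∈ definedWords δ q} := by
  ext v
  simp [definedWords, stepWord_append, h]

theorem definedWordsUpTo_stable_subset {j : ℕ}
    (hj : ∀ p q, definedWordsUpTo δ j p = definedWordsUpTo δ j q →
      definedWordsUpTo δ (j + 1) p = definedWordsUpTo δ (j + 1) q)
    {p q : Q} (h : definedWordsUpTo δ (j + 1) p = definedWordsUpTo δ (j + 1) q) :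
    definedWordsUpTo δ (j + 2) p ⊆ definedWordsUpTo δ (j + 2) q := by
  rintro (_ | ⟨a, u⟩) ⟨hlen, hu⟩
  · exact ⟨hlen, rfl⟩
  refine ⟨hlen, ?_⟩
  simp only [Set.mem_ofPred_eq, List.length_cons] at hlen
  have mem_iff : ∀ v : List A, v.length ≤ j →
      (a :: v ∈ definedWords δ p ↔ a :: v ∈ definedWords δ q) := by
    intro v hv
    have := Set.ext_iff.1 h (a :: v)
    simpa [definedWordsUpTo, hv] using this
  have ha := mem_iff [] (Nat.zero_le _)
  cases hp : δ p a with
  | none => simp [definedWords, stepWord, hp] at hu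
  | some p' =>
    cases hq : δ q a with
    | none => simp [definedWords, stepWord, hp, hq] at ha
    | some q' =>
      have hpq : definedWordsUpTo δ j p' = definedWordsUpTo δ j q' := by
        ext v
        simp only [definedWordsUpTo, Set.mem_inter_iff, Set.mem_ofPred_eq]
        refine and_congr_right fun hv => ?_
        simpa [definedWords, stepWord, hp, hq] using mem_iff v hv
      have hu' : u ∈ definedWordsUpTo δ (j + 1) p' :=
        ⟨by simpa using hlen, by simpa [definedWords, stepWord, hp] using hu⟩
      rw [hj _ _ hpq] at hu'
      simpa [definedWords, stepWord, hq] using hu'.2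

theorem definedWordsUpTo_stable_succ {j : ℕ}
    (hj : ∀ p q, definedWordsUpTo δ j p = definedWordsUpTo δ j q →
      definedWordsUpTo δ (j + 1) p = definedWordsUpTo δ (j + 1) q) (p q : Q)
    (h : definedWordsUpTo δ (j + 1) p = definedWordsUpTo δ (j + 1) q) :
    definedWordsUpTo δ (j + 2) p = definedWordsUpTo δ (j + 2) q :=
  (definedWordsUpTo_stable_subset δ hj h).antisymm (definedWordsUpTo_stable_subset δ hj h.symm)

theorem inter_definedWordsUpTo {i j : ℕ} (hij : i ≤ j) (q : Q) :
    {u | u.length ≤ i} ∩ definedWordsUpTo δ j q = definedWordsUpTo δ i q := by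
  ext u
  simp only [definedWordsUpTo, Set.mem_inter_iff, Set.mem_ofPred_eq]
  exact ⟨fun h => ⟨h.1, h.2.2⟩, fun h => ⟨h.1, h.1.trans hij, h.2⟩⟩

theorem ncard_range_definedWordsUpTo_lt [Finite Q] {j : ℕ} {p q : Q}
    (h : definedWordsUpTo δ j p = definedWordsUpTo δ j q)
    (hne : definedWordsUpTo δ (j + 1) p ≠ definedWordsUpTo δ (j + 1) q) :
    (Set.range (definedWordsUpTo δ j)).ncard < (Set.range (definedWordsUpTo δ (j + 1))).ncard := by
  have himg : Set.range (definedWordsUpTo δ j) =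
      (fun L => {u : List A | u.length ≤ j} ∩ L) '' Set.range (definedWordsUpTo δ (j + 1)) := by
    rw [← Set.range_comp]
    exact congrArg Set.range (funext fun q => (inter_definedWordsUpTo δ j.le_succ q).symm)
  rw [himg]
  refine lt_of_le_of_ne (Set.ncard_image_le (Set.finite_range _)) fun heq => hne ?_
  refine Set.injOn_of_ncard_image_eq heq (Set.finite_range _) ⟨p, rfl⟩ ⟨q, rfl⟩ ?_
  simpa only [inter_definedWordsUpTo δ j.le_succ] using h

theorem succ_le_ncard_range_definedWordsUpTo [Finite Q] {m : ℕ} {p q : Q}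
    (h : definedWordsUpTo δ m p = definedWordsUpTo δ m q)
    (hne : definedWordsUpTo δ (m + 1) p ≠ definedWordsUpTo δ (m + 1) q) :
    m + 1 ≤ (Set.range (definedWordsUpTo δ m)).ncard := by
  induction m generalizing p q with
  | zero => exact (Set.ncard_pos (Set.finite_range _)).2 ⟨_, p, rfl⟩
  | succ m ih =>
    by_cases hj : ∀ p q, definedWordsUpTo δ m p = definedWordsUpTo δ m q →
        definedWordsUpTo δ (m + 1) p = definedWordsUpTo δ (m + 1) q
    · exact absurd (definedWordsUpTo_stable_succ δ hj p q h) hne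
    · push Not at hj
      obtain ⟨p', q', h', hne'⟩ := hj
      exact (ih h' hne').trans_lt (ncard_range_definedWordsUpTo_lt δ h' hne')

theorem kappa_img_of_mem_of_notMem [Finite Q] {S : Set Q} {w : List A} {p q : Q}
    (hp : p ∈ S) (hq : q ∈ S) (hwp : w ∈ definedWords δ p) (hwq : w ∉ definedWords δ q) :
    1 ≤ kappa δ (img δ S w) ∧ kappa δ (img δ S w) < kappa δ S := by
  simp only [kappa_eq_ncard_image]
  constructor
  · obtain ⟨r, hr⟩ := Option.isSome_iff_exists.1 hwp
    exact (Set.ncard_pos (Set.toFinite _)).2 ⟨_, r, ⟨p, hp, hr⟩, rfl⟩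
  · have hsub : definedWords δ '' img δ S w ⊆
        (fun L => {v | w ++ v ∈ L}) '' {L ∈ definedWords δ '' S | w ∈ L} := by
      rintro _ ⟨r, ⟨s, hs, hr⟩, rfl⟩
      exact ⟨definedWords δ s, ⟨⟨s, hs, rfl⟩, Option.isSome_iff_exists.2 ⟨r, hr⟩⟩,
        (definedWords_of_stepWord_eq_some δ hr).symm⟩
    have hfin : {L ∈ definedWords δ '' S | w ∈ L}.Finite :=
      (Set.toFinite _).subset (Set.sep_subset _ _)
    refine ((Set.ncard_le_ncard hsub (hfin.image _)).trans (Set.ncard_image_le hfin)).trans_lt ?_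
    refine Set.ncard_lt_ncard ⟨Set.sep_subset _ _, fun hle => ?_⟩ (Set.toFinite _)
    exact hwq (hle ⟨q, hq, rfl⟩).2

theorem kappa_univ_le_add_ncard_compl [Finite Q] (S : Set Q) :
    kappa δ Set.univ ≤ kappa δ S + Sᶜ.ncard := by
  simp only [kappa_eq_ncard_image]
  rw [← Set.union_compl_self S, Set.image_union]
  exact (Set.ncard_union_le _ _).trans (Nat.add_le_add_left (Set.ncard_image_le (Set.toFinite _)) _)

theorem ncard_range_definedWordsUpTo_add_kappa_le [Finite Q] {S : Set Q} {m : ℕ} {p : Q}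
    (hS : ∀ q ∈ S, definedWordsUpTo δ m q = definedWordsUpTo δ m p) :
    (Set.range (definedWordsUpTo δ m)).ncard + kappa δ S ≤ kappa δ Set.univ + 1 := by
  simp only [kappa_eq_ncard_image]
  set T := definedWords δ '' S
  set U := definedWords δ '' Set.univ
  have hTU : T ⊆ U := Set.image_mono (Set.subset_univ S)
  have hsub : Set.range (definedWordsUpTo δ m) ⊆ insert (definedWordsUpTo δ m p)
      ((fun L => {u : List A | u.length ≤ m} ∩ L) '' (U \ T)) := by
    rintro _ ⟨q, rfl⟩
    by_cases hq : definedWords δ q ∈ T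
    · obtain ⟨s, hs, hsq⟩ := hq
      left
      rw [← hS s hs, definedWordsUpTo, definedWordsUpTo, hsq]
    · exact Or.inr ⟨_, ⟨⟨q, trivial, rfl⟩, hq⟩, rfl⟩
  have hfin : (U \ T).Finite := (Set.toFinite U).subset Set.sdiff_subset
  have h1 := Set.ncard_le_ncard hsub ((hfin.image _).insert _)
  have h2 := Set.ncard_insert_le (definedWordsUpTo δ m p)
    ((fun L => {u : List A | u.length ≤ m} ∩ L) '' (U \ T))
  have h3 := Set.ncard_image_le (f := fun L => {u : List A | u.length ≤ m} ∩ L) hfin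
  have h4 := Set.ncard_sdiff_add_ncard_of_subset hTU (Set.toFinite U)
  omega

theorem exists_definedWordsUpTo_ne [Finite Q] {S : Set Q} (hS : 2 ≤ kappa δ S) :
    ∃ k, ∃ p ∈ S, ∃ q ∈ S, definedWordsUpTo δ k p ≠ definedWordsUpTo δ k q := by
  rw [kappa_eq_ncard_image] at hS
  obtain ⟨_, _, ⟨p, hp, rfl⟩, ⟨q, hq, rfl⟩, hne⟩ :=
    (Set.one_lt_ncard_iff (Set.toFinite _)).1 hS
  by_contra! hcon
  refine hne (Set.ext fun u => ?_)
  simpa [definedWordsUpTo] using Set.ext_iff.1 (hcon u.length p hp q hq) u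

end Helpers

/-- If `κ(S) ≥ 2`, then there is a word `w` of length at most
`κ(Q) − κ(S) + 1 ≤ n − |S| + 1` such that `1 ≤ κ(δ(S,w)) < κ(S)`. -/
theorem stmt0 {Q A : Type*} [Fintype Q] (δ : Q → A → Option Q) (S : Set Q)
    (hS : 2 ≤ kappa δ S) :
    kappa δ Set.univ - kappa δ S + 1 ≤ Fintype.card Q - S.ncard + 1 ∧
    ∃ w : List A, w.length ≤ kappa δ Set.univ - kappa δ S + 1 ∧
      1 ≤ kappa δ (img δ S w) ∧ kappa δ (img δ S w) < kappa δ S := by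
  constructor
  · have h1 := kappa_univ_le_add_ncard_compl δ S
    have h2 := Set.ncard_add_ncard_compl S
    rw [Nat.card_eq_fintype_card] at h2
    omega
  · have hex := exists_definedWordsUpTo_ne δ hS
    obtain ⟨p, hp, q, hq, hne⟩ := Nat.find_spec hex
    have hmin := fun m => Nat.find_min hex (m := m)
    generalize Nat.find hex = k at hne hmin
    cases k with
    | zero =>
      refine absurd (Set.ext fun u => ?_) hne
      cases u <;> simp [definedWordsUpTo, definedWords, stepWord]
    | succ m =>
      have hsame : ∀ r ∈ S, definedWordsUpTo δ m r = definedWordsUpTo δ m p := by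
        have := hmin m m.lt_succ_self
        push Not at this
        exact fun r hr => this r hr p hp
      have h1 := succ_le_ncard_range_definedWordsUpTo δ (hsame q hq).symm hne
      have h2 := ncard_range_definedWordsUpTo_add_kappa_le δ hsame
      obtain ⟨w, hw⟩ : ∃ w, ¬(w ∈ definedWordsUpTo δ (m + 1) p ↔
          w ∈ definedWordsUpTo δ (m + 1) q) := by
        by_contra! hcon
        exact hne (Set.ext hcon)
      simp only [definedWordsUpTo, Set.mem_inter_iff, Set.mem_ofPred_eq] at hw
      refine ⟨w, ?_, ?_⟩
      · have : w.length ≤ m + 1 := by tauto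
        omega
      · by_cases hwp : w ∈ definedWords δ p
        · exact kappa_img_of_mem_of_notMem δ hp hq hwp (by tauto)
        · exact kappa_img_of_mem_of_notMem δ hq hp (by tauto) hwp
end

section
/- Let A = (Q, Σ, δ) be a partial DFA and let S ⊆ Q be a non-empty subset. For every word w ∈ Σ*, there exists a word w' ∈ Σ* with |w'| ≤ |w| such that ∅ ≠ δ(S,w') ⊆ δ^F(S,w). In particular, if w has rank r in the fixing automaton A^F, then w' has rank r' in A with 1 ≤ r' ≤ r. -/
open scoped Classical

theorem img_cons {Q A : Type*} (δ : Q → A → Option Q) (S : Set Q) (a : A) (w : List A) :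
    img δ S (a :: w) = img δ {p | ∃ q ∈ S, δ q a = some p} w := by
  ext p
  simp only [img, stepWord, Set.mem_ofPred_eq, Option.bind_eq_some_iff]
  constructor
  · rintro ⟨q, hq, r, hr, h⟩
    exact ⟨r, ⟨q, hq, hr⟩, h⟩
  · rintro ⟨r, ⟨q, hq, hr⟩, h⟩
    exact ⟨q, hq, r, hr, h⟩

theorem exists_img_nonempty_subset_imgC_fixDelta {Q A : Type*} (δ : Q → A → Option Q)
    (w : List A) (S : Set Q) (hS : S.Nonempty) :
    ∃ w' : List A, w'.length ≤ w.length ∧ (img δ S w').Nonempty ∧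
      img δ S w' ⊆ imgC (fixDelta δ) S w := by
  induction w generalizing S with
  | nil =>
    have h : img δ S [] = S := by simp [img, stepWord]
    exact ⟨[], le_rfl, h.symm ▸ hS, by simp [h, imgC, stepWordC]⟩
  | cons a w ih =>
    by_cases hT : {p | ∃ q ∈ S, δ q a = some p}.Nonempty
    · obtain ⟨w', hlen, hne, hsub⟩ := ih _ hT
      refine ⟨a :: w', by simpa using hlen, by rwa [img_cons], ?_⟩
      rw [img_cons]
      refine hsub.trans ?_
      rintro _ ⟨p, ⟨q, hq, hqp⟩, rfl⟩
      exact ⟨q, hq, by simp [stepWordC, fixDelta, hqp]⟩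
    · obtain ⟨w', hlen, hne, hsub⟩ := ih S hS
      refine ⟨w', hlen.trans (by simp), hne, hsub.trans ?_⟩
      rintro _ ⟨q, hq, rfl⟩
      have hqa : δ q a = none :=
        Option.eq_none_iff_forall_ne_some.2 fun p hp => hT ⟨p, q, hq, hp⟩
      exact ⟨q, hq, by simp [stepWordC, fixDelta, hqa]⟩

/-- For non-empty `S` and every word `w` there is `w'` with `|w'| ≤ |w|` and
`∅ ≠ δ(S,w') ⊆ δ^F(S,w)`; in particular (taking `S = Q`), if `w` has rank `r` in `A^F`
then `w'` has rank `r'` in `A` with `1 ≤ r' ≤ r`. -/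
theorem stmt3 {Q A : Type*} [Fintype Q] (δ : Q → A → Option Q) (S : Set Q)
    (hS : S.Nonempty) (w : List A) :
    ∃ w' : List A, w'.length ≤ w.length ∧ (img δ S w').Nonempty ∧
      img δ S w' ⊆ imgC (fixDelta δ) S w ∧
      (S = Set.univ →
        1 ≤ (img δ Set.univ w').ncard ∧
        (img δ Set.univ w').ncard ≤ (imgC (fixDelta δ) Set.univ w).ncard) := by
  obtain ⟨w', hlen, hne, hsub⟩ := exists_img_nonempty_subset_imgC_fixDelta δ w S hS
  refine ⟨w', hlen, hne, hsub, ?_⟩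
  rintro rfl
  exact ⟨(Set.ncard_pos (Set.toFinite _)).2 hne, Set.ncard_le_ncard hsub (Set.toFinite _)⟩
end

section
/- For every partial DFA A with non-empty state set, the minimal non-zero rank of A (the minimum of |δ(Q,w)| over all words w with δ(Q,w) ≠ ∅) is at most the minimal rank of its fixing automaton A^F (the minimum of |δ^F(Q,w)| over all words w). -/
open scoped Classical

/-- Reading `w` and skipping every letter undefined on the whole current set yields a word whose
partial action stays inside the action of `w` in the fixing automaton. -/
theorem exists_img_subset_imgC_fixDelta {Q A : Type*} (δ : Q → A → Option Q) (w : List A) :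
    ∀ S T : Set Q, S.Nonempty → S ⊆ T →
      ∃ u : List A, (img δ S u).Nonempty ∧ img δ S u ⊆ imgC (fixDelta δ) T w := by
  induction w with
  | nil =>
    rintro S T ⟨q, hq⟩ hST
    refine ⟨[], ⟨q, q, hq, rfl⟩, ?_⟩
    rintro p ⟨q', hq', h⟩
    exact ⟨q', hST hq', Option.some.inj h⟩
  | cons a w ih =>
    intro S T hS hST
    have imgC_cons : imgC (fixDelta δ) T (a :: w) =
        imgC (fixDelta δ) ((fun q => fixDelta δ q a) '' T) w := by
      simp only [imgC, Set.image_image, stepWordC, List.foldl_cons]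
    rw [imgC_cons]
    by_cases hne : ∃ q ∈ S, ∃ p, δ q a = some p
    · obtain ⟨q, hq, p, hp⟩ := hne
      have img_cons (u : List A) :
          img δ S (a :: u) = img δ {p | ∃ q ∈ S, δ q a = some p} u := by
        ext r
        simp only [img, stepWord, Set.mem_ofPred_eq, Option.bind_eq_some_iff]
        grind
      obtain ⟨u, hu⟩ := ih {p | ∃ q ∈ S, δ q a = some p} ((fun q => fixDelta δ q a) '' T)
        ⟨p, q, hq, hp⟩ (by
          rintro r ⟨q', hq', hr⟩
          exact ⟨q', hST hq', by simp [fixDelta, hr]⟩)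
      exact ⟨a :: u, by rwa [img_cons]⟩
    · refine ih S _ hS fun q hq => ⟨q, hST hq, ?_⟩
      have hnone : δ q a = none :=
        Option.eq_none_iff_forall_ne_some.mpr fun p hp => hne ⟨q, hq, p, hp⟩
      simp [fixDelta, hnone]

/-- The minimal non-zero rank of a partial DFA `A` is at most the minimal
rank of its fixing automaton `A^F`. -/
theorem stmt4 {Q A : Type*} [Fintype Q] [Nonempty Q] (δ : Q → A → Option Q) :
    sInf {r : ℕ | ∃ w : List A, (img δ Set.univ w).ncard = r ∧ r ≠ 0} ≤
      sInf {r : ℕ | ∃ w : List A, (imgC (fixDelta δ) Set.univ w).ncard = r} := by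
  obtain ⟨w, hw⟩ := Nat.sInf_mem
    (s := {r : ℕ | ∃ w : List A, (imgC (fixDelta δ) Set.univ w).ncard = r}) ⟨_, [], rfl⟩
  rw [← hw]
  obtain ⟨u, hne, hsub⟩ :=
    exists_img_subset_imgC_fixDelta δ w Set.univ Set.univ Set.univ_nonempty subset_rfl
  refine le_trans (Nat.sInf_le ?_) (Set.ncard_le_ncard hsub)
  exact ⟨u, rfl, hne.ncard_pos.ne'⟩
end

section
/- Let A = (Q, Σ, δ) be a strongly connected partial DFA and let T be a collecting tree of A with root class [r]. If there is a word over Σ ∪ {γ} that synchronizes [r] in the collecting automaton A^{C(T)}, then there is a word over Σ of length at most that of the former that synchronizes [r] in A^{C(T)}. -/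
open scoped Classical

variable {Q A : Type*}

/-- The transition function of the collecting automaton `A^{C(T)}`, a complete DFA over
the alphabet `Option A`, where `none` plays the role of the fresh letter `γ`.
The collecting tree `T` is encoded by a root state `r` (its class being the root class
`[r]`) and a function `τ` choosing, for each state `q`, the letter labeling the unique
edge of `T` leaving the class `[q]`. On letters `some a` it acts as the fixing automaton;
the letter `γ = none` acts on `q ∉ [r]` by the letter `τ q`, and as the identity on `[r]`. -/
noncomputable def collectDelta (δ : Q → A → Option Q) (r : Q) (τ : Q → A) :
    Q → Option A → Q
  | q, some a => fixDelta δ q a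
  | q, none => if Insep δ q r then q else (δ q (τ q)).getD q

/-- `τ` (together with the root `r`) encodes a collecting tree: it is constant on
inseparability classes, defined outside the root class, and iterating the `γ`-step from
any state eventually reaches the root class (the tree is directed toward `[r]`). -/
def IsCollectingTree (δ : Q → A → Option Q) (r : Q) (τ : Q → A) : Prop :=
  (∀ p q : Q, Insep δ p q → τ p = τ q) ∧
  (∀ q : Q, ¬ Insep δ q r → (δ q (τ q)).isSome) ∧
  (∀ q : Q, ∃ k : ℕ, Insep δ ((fun p => collectDelta δ r τ p none)^[k] q) r)

theorem Insep.isSome_step_iff {δ : Q → A → Option Q} {p q : Q} (h : Insep δ p q) (a : A) :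
    (δ p a).isSome ↔ (δ q a).isSome := by
  have h1 := h [a]
  simp only [stepWord] at h1
  cases hp : δ p a <;> cases hq : δ q a <;> simp_all

/-- Every letter of the fixing automaton preserves inseparability. -/
theorem Insep.fixDelta {δ : Q → A → Option Q} {p q : Q} (h : Insep δ p q) (a : A) :
    Insep δ (fixDelta δ p a) (fixDelta δ q a) := by
  have h0 := h.isSome_step_iff a
  unfold _root_.fixDelta
  cases hp : δ p a <;> cases hq : δ q a
  · simpa using h
  · simp [hp, hq] at h0
  · simp [hp, hq] at h0
  · intro u
    have h1 := h (a :: u)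
    simpa [stepWord, hp, hq] using h1

/-- On a single inseparability class, the letter `none` acts either as the identity or as
a letter of `A`, so every word acts there as a word over `A` that is not longer. -/
theorem exists_word_agreeing_on_class (δ : Q → A → Option Q) (r : Q) (τ : Q → A)
    (hτ : ∀ p q : Q, Insep δ p q → τ p = τ q) (w' : List (Option A)) (p : Q) :
    ∃ w : List A, w.length ≤ w'.length ∧ ∀ q, Insep δ q p →
      stepWordC (collectDelta δ r τ) q w' =
        stepWordC (collectDelta δ r τ) q (w.map some) := by
  induction w' generalizing p with
  | nil => exact ⟨[], le_rfl, fun _ _ => rfl⟩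
  | cons x t ih =>
    have step (a : A) (hx : ∀ q, Insep δ q p → collectDelta δ r τ q x = fixDelta δ q a) :
        ∃ w : List A, w.length ≤ (x :: t).length ∧ ∀ q, Insep δ q p →
          stepWordC (collectDelta δ r τ) q (x :: t) =
            stepWordC (collectDelta δ r τ) q (w.map some) := by
      obtain ⟨w, hl, hw⟩ := ih (fixDelta δ p a)
      refine ⟨a :: w, by simpa using hl, fun q hq => ?_⟩
      have h := hw _ (hq.fixDelta a)
      rw [stepWordC, List.foldl_cons, hx q hq]
      exact h
    cases x with
    | some a => exact step a fun _ _ => rfl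
    | none =>
      by_cases hp : Insep δ p r
      · obtain ⟨w, hl, hw⟩ := ih p
        refine ⟨w, hl.trans (by simp), fun q hq => ?_⟩
        have hqr : Insep δ q r := fun u => (hq u).trans (hp u)
        have h := hw q hq
        simpa [stepWordC, collectDelta, hqr] using h
      · refine step (τ p) fun q hq => ?_
        have hqr : ¬ Insep δ q r := fun h => hp fun u => (hq u).symm.trans (h u)
        simp [collectDelta, hqr, fixDelta, hτ q p hq]

/-- If some word over `Σ ∪ {γ}` synchronizes the root class `[r]` in the
collecting automaton `A^{C(T)}`, then some word over `Σ` of at most the same length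
synchronizes `[r]` in `A^{C(T)}`. -/
theorem stmt8 {Q A : Type*} [Fintype Q] (δ : Q → A → Option Q)
    (hsc : StronglyConnected δ) (r : Q) (τ : Q → A) (hT : IsCollectingTree δ r τ)
    (w' : List (Option A))
    (hw' : (imgC (collectDelta δ r τ) {q | Insep δ q r} w').ncard = 1) :
    ∃ w : List A, w.length ≤ w'.length ∧
      (imgC (collectDelta δ r τ) {q | Insep δ q r} (w.map some)).ncard = 1 := by
  obtain ⟨w, hl, hw⟩ := exists_word_agreeing_on_class δ r τ hT.1 w' r
  refine ⟨w, hl, ?_⟩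
  rw [← hw']
  exact congrArg Set.ncard (Set.image_congr fun q hq => (hw q hq).symm)
end
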